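/- arXiv:2207.12905 — 3 statements merged into one kernel-verified Lean document; each statement's English description precedes it below -/
import Mathlib

section
/- Let S be an unbounded characteristic subset of [0, ∞), let η ∈ (0, ∞), let X be a strongly 0-dimensional, σ-compact, locally compact metrizable topological space, and let A be a non-empty non-compact closed subset of X. For every proper ultrametric d on A taking values in S and generating the subspace topology of A, there exists a proper ultrametric D on X taking values in S and generating the topology of X such that the restriction of D to A × A equals d and A is η-dense in (X, D), i.e., for every x ∈ X there exists a ∈ A with D(x, a) ≤ η. -/
/-- An ultrametric (given as a distance function) on a topological space that
generates its topology. -/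
def IsUltrametricGen {X : Type*} [TopologicalSpace X] (d : X → X → ℝ) : Prop :=
  (∀ x y, 0 ≤ d x y) ∧
  (∀ x y, d x y = 0 ↔ x = y) ∧
  (∀ x y, d x y = d y x) ∧
  (∀ x y z, d x z ≤ max (d x y) (d y z)) ∧
  (∀ s : Set X, IsOpen s ↔ ∀ x ∈ s, ∃ ε > 0, ∀ y, d x y < ε → y ∈ s)

/-- A metric is proper if every bounded closed subset is compact. -/
def IsProperMetric {X : Type*} [TopologicalSpace X] (d : X → X → ℝ) : Prop :=
  ∀ s : Set X, IsClosed s → (∃ C, ∀ x ∈ s, ∀ y ∈ s, d x y ≤ C) → IsCompact s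

/-- `S` is a characteristic subset of `[0, ∞)`. -/
def IsCharacteristic (S : Set ℝ) : Prop :=
  S ⊆ Set.Ici 0 ∧ (0 : ℝ) ∈ S ∧ ∀ r : ℝ, 0 < r → ∃ s ∈ S, s ≠ 0 ∧ s ≤ r

/-- A topological space is strongly 0-dimensional if every pair of disjoint
closed sets can be separated by a clopen set. -/
def StronglyZeroDimensional (X : Type*) [TopologicalSpace X] : Prop :=
  ∀ A B : Set X, IsClosed A → IsClosed B → Disjoint A B →
    ∃ V : Set X, IsClopen V ∧ A ⊆ V ∧ Disjoint V B

section Helpers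

open Set Filter Topology TopologicalSpace

/-- A second countable strongly zero-dimensional T₁ space has a countable basis of clopen sets. -/
lemma StronglyZeroDimensional.exists_clopen_seq {X : Type*} [TopologicalSpace X] [T1Space X]
    [SecondCountableTopology X] (hX : StronglyZeroDimensional X) :
    ∃ V : ℕ → Set X, (∀ n, IsClopen (V n)) ∧
      ∀ x (U : Set X), IsOpen U → x ∈ U → ∃ n, x ∈ V n ∧ V n ⊆ U := by
  have hB : IsTopologicalBasis {V : Set X | IsClopen V} := by
    refine isTopologicalBasis_of_isOpen_of_nhds (fun V hV => hV.isOpen) fun x U hx hU => ?_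
    obtain ⟨V, hV, hxV, hVU⟩ := hX {x} Uᶜ isClosed_singleton hU.isClosed_compl
      (by simpa using hx)
    exact ⟨V, hV, hxV rfl, disjoint_compl_right_iff_subset.1 hVU⟩
  obtain ⟨s, hs, hsc, hsB⟩ := hB.exists_countable
  obtain ⟨V, hV⟩ := (hsc.insert ∅).exists_eq_range ⟨∅, mem_insert _ _⟩
  refine ⟨V, fun n => ?_, fun x U hU hx => ?_⟩
  · obtain h | h : V n ∈ insert ∅ s := hV ▸ mem_range_self n
    · exact h ▸ isClopen_empty
    · exact hs h
  · obtain ⟨W, hW, hxW, hWU⟩ := hsB.exists_subset_of_mem_open hx hU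
    obtain ⟨n, rfl⟩ : W ∈ range V := hV ▸ mem_insert_of_mem _ hW
    exact ⟨n, hxW, hWU⟩

/-- A space covered by countably many compact clopen sets admits a proper map to `ℕ`. -/
lemma exists_isProperMap_nat {X : Type*} [TopologicalSpace X] (W : ℕ → Set X)
    (hW : ∀ n, IsClopen (W n)) (hWc : ∀ n, IsCompact (W n)) (hcov : ∀ x, ∃ n, x ∈ W n) :
    ∃ h : X → ℕ, IsProperMap h := by
  classical
  let h : X → ℕ := fun x => Nat.find (hcov x)
  have hcont : Continuous h := by
    refine continuous_discrete_rng.2 fun n => ?_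
    have : h ⁻¹' {n} = W n ∩ ⋂ i ∈ Finset.range n, (W i)ᶜ := by
      ext x
      simp [h, Nat.find_eq_iff]
    rw [this]
    exact (hW n).isOpen.inter (isOpen_biInter_finset fun i _ => (hW i).isClosed.isOpen_compl)
  refine ⟨h, isProperMap_iff_isCompact_preimage.2 ⟨hcont, fun K hK => ?_⟩⟩
  have hcpt : IsCompact (⋃ i ∈ K, W i) := hK.finite_of_discrete.isCompact_biUnion fun i _ => hWc i
  exact hcpt.of_isClosed_subset (hK.isClosed.preimage hcont) fun x hx =>
    mem_biUnion hx (Nat.find_spec (hcov x))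

/-- A proper map to `ℕ` can be modified so that a given closed non-compact set meets each of its
nonempty fibers. -/
lemma IsProperMap.exists_nat_image_eq {X : Type*} [TopologicalSpace X] {h : X → ℕ}
    (hh : IsProperMap h) {A : Set X} (hA : IsClosed A) (hnc : ¬ IsCompact A) :
    ∃ g : X → ℕ, IsProperMap g ∧ ∀ x, ∃ a ∈ A, g a = g x := by
  classical
  have hex : ∀ n, ∃ k, k ∈ h '' A ∧ n ≤ k := by
    intro n
    by_contra! hcon
    refine hnc ((hh.isCompact_preimage (finite_Iio n).isCompact).of_isClosed_subset hA ?_)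
    exact fun a ha => hcon _ (mem_image_of_mem h ha)
  let p : ℕ → ℕ := fun n => Nat.find (hex n)
  have hp : IsProperMap p := by
    refine isProperMap_iff_isCompact_preimage.2 ⟨continuous_of_discreteTopology, fun K hK => ?_⟩
    obtain ⟨m, hm⟩ := hK.bddAbove
    exact ((finite_Iic m).subset fun n hn =>
      (Nat.find_spec (hex n)).2.trans (hm hn)).isCompact
  refine ⟨p ∘ h, hp.comp hh, fun x => ?_⟩
  obtain ⟨a, ha, hax⟩ := (Nat.find_spec (hex (h x))).1
  refine ⟨a, ha, ?_⟩
  change p (h a) = p (h x)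
  rw [hax]
  have h₁ := Nat.find_spec (hex (p (h x)))
  refine le_antisymm (Nat.find_min' _ ⟨(Nat.find_spec (hex (h x))).1, le_rfl⟩) h₁.2

/-- Given a proper map to `ℕ` all of whose nonempty fibers meet the closed set `A`, there is a
proper retraction onto `A`. -/
lemma exists_isProperMap_retraction {X : Type*} [TopologicalSpace X] [T2Space X]
    (V : ℕ → Set X) (hV : ∀ n, IsClopen (V n)) (hsep : ∀ x y, x ≠ y → ∃ n, x ∈ V n ∧ y ∉ V n)
    {A : Set X} (hA : IsClosed A) (hne : A.Nonempty) {g : X → ℕ} (hg : IsProperMap g)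
    (hgA : ∀ x, ∃ a ∈ A, g a = g x) :
    ∃ r : X → A, IsProperMap r ∧ ∀ a : A, r a = a := by
  classical
  let φ : X → ℕ → ℕ := fun x n => Nat.casesOn n (g x) fun k => if x ∈ V k then 1 else 0
  have hφ : Continuous φ := by
    refine continuous_pi fun n => ?_
    cases n with
    | zero => exact hg.continuous
    | succ k =>
      exact continuous_const.if (fun a ha => by simp [(hV k).frontier_eq] at ha) continuous_const
  have hinj : Function.Injective φ := by
    intro x y hxy
    by_contra hne
    obtain ⟨n, hx, hy⟩ := hsep x y hne
    have := congrFun hxy (n + 1)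
    simp [φ, hx, hy] at this
  have hφp : IsProperMap φ :=
    isProperMap_of_comp_of_t2 hφ (continuous_apply 0) (by exact hg)
  have hemb : IsClosedEmbedding φ :=
    .of_continuous_injective_isClosedMap hφ hinj hφp.isClosedMap
  obtain ⟨f, hfix, hrange, hlip⟩ := by
    let : MetricSpace (ℕ → ℕ) := PiNat.metricSpace (E := fun _ => ℕ)
    exact PiNat.exists_lipschitz_retraction_of_isClosed (hφp.isClosedMap _ hA) (hne.image φ)
  have hf0 : ∀ u v : ℕ → ℕ, u 0 = v 0 → f u 0 = f v 0 := by
    let : MetricSpace (ℕ → ℕ) := PiNat.metricSpace (E := fun _ => ℕ)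
    intro u v huv
    have h₁ : v ∈ PiNat.cylinder u 1 := fun i hi => by
      obtain rfl : i = 0 := by omega
      exact huv.symm
    have h₂ := hlip.dist_le_mul v u
    rw [NNReal.coe_one, one_mul] at h₂
    have h₃ : f v ∈ PiNat.cylinder (f u) 1 :=
      PiNat.mem_cylinder_iff_dist_le.2 (h₂.trans (PiNat.mem_cylinder_iff_dist_le.1 h₁))
    exact (h₃ 0 one_pos).symm
  have hfc : Continuous f := by
    let : MetricSpace (ℕ → ℕ) := PiNat.metricSpace (E := fun _ => ℕ)
    exact hlip.continuous
  have hr : ∀ x, ∃ a : A, φ a = f (φ x) := fun x => by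
    obtain ⟨a, ha, hax⟩ : f (φ x) ∈ φ '' A := hrange ▸ mem_range_self _
    exact ⟨⟨a, ha⟩, hax⟩
  choose r hr using hr
  have hrc : Continuous r := by
    rw [(hemb.isInducing.comp IsInducing.subtypeVal).continuous_iff]
    exact (hfc.comp hφ).congr fun x => (hr x).symm
  refine ⟨r, isProperMap_of_comp_of_t2 hrc (hg.continuous.comp continuous_subtype_val) ?_,
    fun a => Subtype.ext (hinj ((hr a).trans (hfix _ (mem_image_of_mem φ a.2))))⟩
  convert hg using 1
  funext x
  obtain ⟨a, ha, hax⟩ := hgA x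
  calc g (r x) = f (φ x) 0 := congrFun (hr x) 0
    _ = f (φ a) 0 := hf0 _ _ hax.symm
    _ = g x := by rw [hfix _ (mem_image_of_mem φ ha)]; exact hax

/-- A characteristic set contains an antitone sequence of positive numbers below `η` tending
to zero. -/
lemma IsCharacteristic.exists_seq {S : Set ℝ} (hS : IsCharacteristic S) {η : ℝ} (hη : 0 < η) :
    ∃ s : ℕ → ℝ, Antitone s ∧ (∀ n, s n ∈ S) ∧ (∀ n, 0 < s n) ∧ (∀ n, s n ≤ η) ∧
      Tendsto s atTop (𝓝 0) := by
  have hf : ∀ r : ℝ, ∃ t, 0 < r → t ∈ S ∧ 0 < t ∧ t ≤ r := fun r => by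
    by_cases hr : 0 < r
    · obtain ⟨t, ht, ht0, htr⟩ := hS.2.2 r hr
      exact ⟨t, fun _ => ⟨ht, lt_of_le_of_ne (hS.1 ht) ht0.symm, htr⟩⟩
    · exact ⟨0, fun h => absurd h hr⟩
  choose f hf using hf
  let s : ℕ → ℝ := fun n => Nat.rec (f η) (fun _ t => f (t / 2)) n
  have hpos : ∀ n, 0 < s n := fun n => by
    induction n with
    | zero => exact (hf η hη).2.1
    | succ n ih => exact (hf _ (half_pos ih)).2.1
  have hhalf : ∀ n, s (n + 1) ≤ s n / 2 := fun n => (hf _ (half_pos (hpos n))).2.2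
  have hanti : Antitone s := antitone_nat_of_succ_le fun n => by linarith [hhalf n, hpos n]
  have hle : ∀ n, s n ≤ η * (1 / 2) ^ n := fun n => by
    induction n with
    | zero => simpa [s] using (hf η hη).2.2
    | succ n ih => rw [pow_succ]; linarith [hhalf n]
  refine ⟨s, hanti, fun n => ?_, hpos, fun n => (hanti n.zero_le).trans (hf η hη).2.2, ?_⟩
  · cases n with
    | zero => exact (hf η hη).1
    | succ n => exact (hf _ (half_pos (hpos n))).1
  · refine squeeze_zero (fun n => (hpos n).le) hle ?_
    simpa using (tendsto_pow_atTop_nhds_zero_of_lt_one (r := (1 / 2 : ℝ))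
      (by norm_num) (by norm_num)).const_mul η

/-- The pseudo-ultrametric determined by a sequence of clopen sets `U n` and an antitone null
sequence `s`: the distance of two points is `s n` for the first `n` such that `U n` separates
them. -/
lemma exists_pseudoUltrametric {X : Type*} [TopologicalSpace X] {U : ℕ → Set X}
    (hU : ∀ n, IsClopen (U n)) {s : ℕ → ℝ} (hs : Antitone s) (hpos : ∀ n, 0 < s n)
    (hlim : Tendsto s atTop (𝓝 0)) :
    ∃ ρ : X → X → ℝ, (∀ x y, ρ x y = 0 ∨ ∃ n, ρ x y = s n) ∧
      (∀ x y, ρ x y = 0 ↔ ∀ n, x ∈ U n ↔ y ∈ U n) ∧ (∀ x y, ρ x y = ρ y x) ∧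
      (∀ x y z, ρ x z ≤ max (ρ x y) (ρ y z)) ∧ ∀ x, ∀ ε > 0, ∀ᶠ y in 𝓝 x, ρ x y < ε := by
  classical
  let ρ : X → X → ℝ := fun x y =>
    if h : ∃ n, ¬ (x ∈ U n ↔ y ∈ U n) then s (Nat.find h) else 0
  have hle : ∀ x y n, ¬ (x ∈ U n ↔ y ∈ U n) → s n ≤ ρ x y := fun x y n hn => by
    have h : ∃ n, ¬ (x ∈ U n ↔ y ∈ U n) := ⟨n, hn⟩
    simp only [ρ, dif_pos h]
    exact hs (Nat.find_min' h hn)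
  have hcases : ∀ x y, (ρ x y = 0 ∧ ∀ n, x ∈ U n ↔ y ∈ U n) ∨
      ∃ n, ρ x y = s n ∧ ¬ (x ∈ U n ↔ y ∈ U n) := fun x y => by
    by_cases h : ∃ n, ¬ (x ∈ U n ↔ y ∈ U n)
    · exact .inr ⟨Nat.find h, dif_pos h, Nat.find_spec h⟩
    · exact .inl ⟨dif_neg h, by push Not at h; exact fun n => by simpa using h n⟩
  have hnn : ∀ x y, 0 ≤ ρ x y := fun x y => by
    obtain h | ⟨n, h, -⟩ := hcases x y
    · exact h.1.ge
    · exact h ▸ (hpos n).le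
  have hsymm : ∀ x y, ρ x y ≤ ρ y x := fun x y => by
    obtain h | ⟨n, h, hn⟩ := hcases x y
    · exact h.1 ▸ hnn y x
    · exact h ▸ hle y x n (by tauto)
  refine ⟨ρ, fun x y => (hcases x y).imp And.left fun ⟨n, h, _⟩ => ⟨n, h⟩, fun x y => ?_,
    fun x y => (hsymm x y).antisymm (hsymm y x), fun x y z => ?_, fun x ε hε => ?_⟩
  · refine ⟨fun h n => ?_, fun h => dif_neg (by simpa using h)⟩
    by_contra hn
    exact ((hpos n).trans_le (hle x y n hn)).ne' h
  · obtain h | ⟨n, h, hn⟩ := hcases x z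
    · exact h.1 ▸ le_max_of_le_left (hnn x y)
    · rw [h]
      by_cases hxy : x ∈ U n ↔ y ∈ U n
      · exact le_max_of_le_right (hle y z n (by tauto))
      · exact le_max_of_le_left (hle x y n hxy)
  · obtain ⟨N, hN⟩ := (hlim.eventually_lt_const hε).exists
    have hev : ∀ᶠ y in 𝓝 x, ∀ n ∈ Finset.range N, x ∈ U n ↔ y ∈ U n := by
      rw [Filter.eventually_all_finset]
      intro n _
      by_cases hx : x ∈ U n
      · filter_upwards [(hU n).isOpen.mem_nhds hx] with y hy using by tauto
      · filter_upwards [(hU n).isClosed.isOpen_compl.mem_nhds hx] with y hy using by tauto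
    filter_upwards [hev] with y hy
    obtain h | ⟨n, h, hn⟩ := hcases x y
    · exact h.1 ▸ hε
    · have hNn : N ≤ n := not_lt.1 fun hlt => hn (hy n (Finset.mem_range.2 hlt))
      exact h ▸ (hs hNn).trans_lt hN

/-- A continuous ultrametric whose bounded closed sets are compact generates the topology. -/
lemma IsProperMetric.isUltrametricGen {X : Type*} [TopologicalSpace X] {D : X → X → ℝ}
    (hD : IsProperMetric D) (hnn : ∀ x y, 0 ≤ D x y) (hzero : ∀ x y, D x y = 0 ↔ x = y)
    (hsymm : ∀ x y, D x y = D y x) (htri : ∀ x y z, D x z ≤ max (D x y) (D y z))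
    (hcont : ∀ x, ∀ ε > 0, ∀ᶠ y in 𝓝 x, D x y < ε) : IsUltrametricGen D := by
  refine ⟨hnn, hzero, hsymm, htri, fun s => ⟨fun hs x hx => ?_, fun h => ?_⟩⟩
  · have hclosed : IsClosed {y | D x y ≤ 1} := by
      rw [← isOpen_compl_iff, isOpen_iff_mem_nhds]
      intro y hy
      filter_upwards [hcont y 1 one_pos] with z hz hxz
      exact hy ((htri x z y).trans (max_le hxz (hsymm y z ▸ hz.le)))
    have hcpt : IsCompact ({y | D x y ≤ 1} \ s) := by
      refine hD _ (hclosed.sdiff hs) ⟨1, fun y hy z hz => ?_⟩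
      exact (htri y x z).trans (max_le (hsymm x y ▸ hy.1) hz.1)
    obtain ⟨ε, hε, hεs⟩ : ∃ ε > 0, ∀ y ∈ {y | D x y ≤ 1} \ s, ε ≤ D x y := by
      refine hcpt.induction_on (p := fun t => ∃ ε > 0, ∀ y ∈ t, ε ≤ D x y) ⟨1, one_pos, by simp⟩
        (fun t t' htt' ⟨ε, hε, h⟩ => ⟨ε, hε, fun y hy => h y (htt' hy)⟩) ?_ fun y hy => ?_
      · rintro t t' ⟨ε, hε, h⟩ ⟨ε', hε', h'⟩
        refine ⟨min ε ε', lt_min hε hε', ?_⟩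
        rintro y (hy | hy)
        · exact min_le_of_left_le (h y hy)
        · exact min_le_of_right_le (h' y hy)
      · have hxy : 0 < D x y := (hnn x y).lt_of_ne' fun h0 => hy.2 ((hzero x y).1 h0 ▸ hx)
        refine ⟨{z | D y z < D x y}, mem_nhdsWithin_of_mem_nhds (hcont y _ hxy), D x y, hxy,
          fun z hz => ?_⟩
        exact (le_max_iff.1 (htri x z y)).resolve_right (hsymm y z ▸ not_le.2 hz)
    refine ⟨min ε 1, lt_min hε one_pos, fun y hy => ?_⟩
    by_contra hys
    exact (hεs y ⟨(hy.trans_le (min_le_right _ _)).le, hys⟩).not_gt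
      (hy.trans_le (min_le_left _ _))
  · refine isOpen_iff_mem_nhds.2 fun x hx => ?_
    obtain ⟨ε, hε, hs⟩ := h x hx
    exact (hcont x ε hε).mono hs

/-- Balls of an ultrametric generating the topology are neighborhoods. -/
lemma IsUltrametricGen.eventually_lt {X : Type*} [TopologicalSpace X] {d : X → X → ℝ}
    (hd : IsUltrametricGen d) (x : X) {ε : ℝ} (hε : 0 < ε) : ∀ᶠ y in 𝓝 x, d x y < ε := by
  obtain ⟨-, hzero, -, htri, hopen⟩ := hd
  refine IsOpen.mem_nhds ((hopen {y | d x y < ε}).2 fun y hy => ⟨ε, hε, fun z hz => ?_⟩) ?_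
  · exact (htri x y z).trans_lt (max_lt hy hz)
  · change d x x < ε
    rwa [(hzero x x).2 rfl]

end Helpers

/-- **Dense extension of proper ultrametrics.** Let `S` be an unbounded
characteristic subset of `[0, ∞)`, `η > 0`, `X` a strongly 0-dimensional
σ-compact locally compact metrizable space, and `A` a non-empty non-compact
closed subset of `X`. Every proper `S`-valued ultrametric `d` on `A` generating
the subspace topology extends to a proper `S`-valued ultrametric `D` on `X`
generating the topology of `X` such that `A` is `η`-dense in `(X, D)`. -/
theorem extend_proper_ultrametric_eta_dense
    {X : Type*} [TopologicalSpace X] [TopologicalSpace.MetrizableSpace X]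
    [SigmaCompactSpace X] [LocallyCompactSpace X]
    (hX : StronglyZeroDimensional X)
    (S : Set ℝ) (hS : IsCharacteristic S) (hSu : ¬ BddAbove S)
    (η : ℝ) (hη : 0 < η)
    (A : Set X) (hA : IsClosed A) (hne : A.Nonempty) (hnc : ¬ IsCompact A)
    (d : A → A → ℝ) (hd : IsUltrametricGen d) (hdS : ∀ a b : A, d a b ∈ S)
    (hdp : IsProperMetric d) :
    ∃ D : X → X → ℝ, IsUltrametricGen D ∧ (∀ x y, D x y ∈ S) ∧
      IsProperMetric D ∧ (∀ a b : A, D a b = d a b) ∧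
      ∀ x : X, ∃ a : A, D x a ≤ η := by
  classical
  let : MetricSpace X := TopologicalSpace.metrizableSpaceMetric X
  obtain ⟨V, hV, hVb⟩ := hX.exists_clopen_seq
  obtain ⟨h, hh⟩ := exists_isProperMap_nat (fun n => if IsCompact (V n) then V n else ∅)
    (fun n => by split_ifs; exacts [hV n, isClopen_empty])
    (fun n => by split_ifs with hc; exacts [hc, isCompact_empty])
    (fun x => by
      obtain ⟨K, hK, hxK⟩ := exists_compact_mem_nhds x
      obtain ⟨n, hxn, hn⟩ := hVb x (interior K) isOpen_interior (mem_interior_iff_mem_nhds.2 hxK)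
      refine ⟨n, ?_⟩
      rwa [if_pos (hK.of_isClosed_subset (hV n).isClosed (hn.trans interior_subset))])
  obtain ⟨g, hg, hgA⟩ := hh.exists_nat_image_eq hA hnc
  obtain ⟨r, hr, hrA⟩ := exists_isProperMap_retraction V hV
    (fun x y hxy => by
      obtain ⟨n, hxn, hn⟩ := hVb x {y}ᶜ isOpen_compl_singleton hxy
      exact ⟨n, hxn, fun hy => hn hy rfl⟩) hA hne hg hgA
  obtain ⟨s, hs, hsS, hspos, hsη, hslim⟩ := hS.exists_seq hη
  let U : ℕ → Set X := fun n => if Disjoint (V n) A then V n else ∅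
  have hU : ∀ n, IsClopen (U n) := fun n => by
    dsimp only [U]; split_ifs; exacts [hV n, isClopen_empty]
  have hUA : ∀ n, ∀ a ∈ A, a ∉ U n := fun n a ha => by
    dsimp only [U]
    split_ifs with hd
    exacts [fun h => Set.disjoint_left.1 hd h ha, id]
  have hUsep : ∀ x y, x ∉ A → x ≠ y → ∃ n, x ∈ U n ∧ y ∉ U n := fun x y hx hxy => by
    obtain ⟨n, hxn, hn⟩ := hVb x (Aᶜ ∩ {y}ᶜ) (hA.isOpen_compl.inter isOpen_compl_singleton)
      ⟨hx, hxy⟩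
    have hd : Disjoint (V n) A := Set.disjoint_left.2 fun z hz => (hn hz).1
    exact ⟨n, by simpa [U, hd] using hxn, by simpa [U, hd] using fun hy => (hn hy).2 rfl⟩
  obtain ⟨ρ, hρval, hρzero, hρsymm, hρtri, hρcont⟩ := exists_pseudoUltrametric hU hs hspos hslim
  have hρA : ∀ a b : A, ρ a b = 0 := fun a b =>
    (hρzero a b).2 fun n => iff_of_false (hUA n a a.2) (hUA n b b.2)
  have hρS : ∀ x y, ρ x y ∈ S := fun x y => by
    obtain h | ⟨n, h⟩ := hρval x y
    exacts [h ▸ hS.2.1, h ▸ hsS n]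
  have hρη : ∀ x y, ρ x y ≤ η := fun x y => by
    obtain h | ⟨n, h⟩ := hρval x y
    exacts [h ▸ hη.le, h ▸ hsη n]
  have hρnn : ∀ x y, 0 ≤ ρ x y := fun x y => hS.1 (hρS x y)
  have hdcont := fun x (ε : ℝ) => hd.eventually_lt (ε := ε) x
  obtain ⟨hdnn, hdzero, hdsymm, hdtri, -⟩ := hd
  let D : X → X → ℝ := fun x y => max (d (r x) (r y)) (ρ x y)
  have hDcont : ∀ x, ∀ ε > 0, ∀ᶠ y in nhds x, D x y < ε := fun x ε hε => by
    filter_upwards [hr.continuous.continuousAt.eventually (hdcont (r x) ε hε), hρcont x ε hε]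
      with y h₁ h₂ using max_lt h₁ h₂
  have hDp : IsProperMetric D := by
    rintro t ht ⟨C, hC⟩
    obtain rfl | ⟨x, hx⟩ := t.eq_empty_or_nonempty
    · exact isCompact_empty
    have hK : IsCompact {b | d (r x) b ≤ max C 1} := by
      refine hdp _ ?_ ⟨max C 1, fun b hb c hc => ?_⟩
      · rw [← isOpen_compl_iff, isOpen_iff_mem_nhds]
        intro b hb
        filter_upwards [hdcont b (max C 1) (by positivity)] with c hc hxc
        exact hb ((hdtri _ c b).trans (max_le hxc (hdsymm b c ▸ hc.le)))
      · exact (hdtri b (r x) c).trans (max_le (hdsymm (r x) b ▸ hb) hc)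
    exact (hr.isCompact_preimage hK).of_isClosed_subset ht fun y hy =>
      ((le_max_left _ _).trans (hC x hx y hy)).trans (le_max_left _ _)
  have hDzero : ∀ x y, D x y = 0 ↔ x = y := fun x y => by
    constructor
    · intro h
      have hρ0 : ρ x y = 0 := le_antisymm (h ▸ le_max_right _ _) (hρnn x y)
      have hd0 : d (r x) (r y) = 0 := le_antisymm (h ▸ le_max_left _ _) (hdnn _ _)
      by_contra hxy
      rw [hρzero] at hρ0
      by_cases hx : x ∈ A
      · by_cases hy : y ∈ A
        · have := (hdzero _ _).1 hd0
          rw [hrA ⟨x, hx⟩, hrA ⟨y, hy⟩] at this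
          exact hxy (congrArg Subtype.val this)
        · obtain ⟨n, h₁, h₂⟩ := hUsep y x hy (Ne.symm hxy)
          exact h₂ ((hρ0 n).2 h₁)
      · obtain ⟨n, h₁, h₂⟩ := hUsep x y hx hxy
        exact h₂ ((hρ0 n).1 h₁)
    · rintro rfl
      simp only [D, (hdzero _ _).2 rfl, (hρzero x x).2 fun _ => Iff.rfl, max_self]
  refine ⟨D, hDp.isUltrametricGen (fun x y => le_max_of_le_left (hdnn _ _)) hDzero
    (fun x y => by simp only [D, hdsymm (r x), hρsymm x]) (fun x y z => ?_) hDcont,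
    fun x y => ?_, hDp, fun a b => ?_, fun x => ⟨r x, ?_⟩⟩
  · refine max_le ((hdtri _ (r y) _).trans ?_) ((hρtri x y z).trans ?_)
    · exact max_le_max (le_max_left _ _) (le_max_left _ _)
    · exact max_le_max (le_max_right _ _) (le_max_right _ _)
  · obtain h | h := max_choice (d (r x) (r y)) (ρ x y)
    exacts [Set.mem_of_eq_of_mem h (hdS _ _), Set.mem_of_eq_of_mem h (hρS x y)]
  · simp only [D, hrA, hρA]
    exact max_eq_left (hdnn a b)
  · simp only [D, hrA, (hdzero _ _).2 rfl]
    exact max_le hη.le (hρη _ _)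
end

section
/- Let S be an unbounded characteristic subset of [0, ∞), let T be a sporadic subset of [0, ∞) with T ⊆ S, let X be an ultrametrizable topological space, let f : X → T be a continuous proper function, and let d be an ultrametric on X taking values in S and generating the topology of X. Define M_T[f](x, y) = M_T(f(x), f(y)) and D(x, y) = max(d(x, y), M_T[f](x, y)). Then D is an ultrametric on X taking values in S generating the topology of X, and D is a proper metric (every bounded closed subset of (X, D) is compact). -/
/-- `S ⊆ [0, ∞)` is sporadic. -/
def Sporadic (S : Set ℝ) : Prop :=
  ∃ s : ℤ → ℝ, StrictMono s ∧ S = insert 0 (Set.range s) ∧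
    Filter.Tendsto s Filter.atBot (nhds 0) ∧
    Filter.Tendsto s Filter.atTop Filter.atTop

open Filter Topology in
/-- Every positive real has a neighborhood meeting a sporadic set in at most that point. -/
theorem Sporadic.eventually_eq {T : Set ℝ} (hT : Sporadic T) {t : ℝ} (ht : 0 < t) :
    ∀ᶠ u in 𝓝 t, u ∈ T → u = t := by
  obtain ⟨s, hs, rfl, hbot, htop⟩ := hT
  obtain ⟨m, hm⟩ := (hbot.eventually_lt_const (half_pos ht)).exists
  obtain ⟨M, hM⟩ := (htop.eventually_gt_atTop (2 * t)).exists
  have hfin : (s '' Set.Icc m M \ {t}).Finite := ((Set.finite_Icc m M).image s).sdiff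
  have hmem : (s '' Set.Icc m M \ {t})ᶜ ∈ 𝓝 t :=
    hfin.isClosed.isOpen_compl.mem_nhds (by simp)
  filter_upwards [hmem, lt_mem_nhds (half_lt_self ht), gt_mem_nhds (by linarith : t < 2 * t)]
    with u hu h₁ h₂ huT
  by_contra hne
  rcases huT with rfl | ⟨k, rfl⟩
  · linarith
  · exact hu ⟨⟨k, ⟨hs.le_iff_le.1 (hm.trans h₁).le, hs.le_iff_le.1 (h₂.trans hM).le⟩, rfl⟩, hne⟩

open Filter Topology in
theorem Sporadic.isClosed {T : Set ℝ} (hT : Sporadic T) (hT₀ : T ⊆ Set.Ici 0) : IsClosed T := by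
  rw [← isOpen_compl_iff, isOpen_iff_mem_nhds]
  intro t ht
  have h₀ : (0 : ℝ) ∈ T := by
    obtain ⟨s, -, rfl, -⟩ := hT
    exact Set.mem_insert _ _
  rcases lt_trichotomy t 0 with h | rfl | h
  · filter_upwards [gt_mem_nhds h] with u hu huT
    exact (hT₀ huT).not_gt hu
  · exact absurd h₀ ht
  · filter_upwards [hT.eventually_eq h] with u hu huT
    exact ht (hu huT ▸ huT)

open Filter Topology in
/-- On a sporadic set, the max-ultrametric is small near each point. -/
theorem Sporadic.eventually_max_lt {T : Set ℝ} (hT : Sporadic T) {t : ℝ} (ht : 0 ≤ t)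
    {ε : ℝ} (hε : 0 < ε) :
    ∀ᶠ u in 𝓝 t, u ∈ T → (if t = u then 0 else max t u) < ε := by
  rcases ht.eq_or_lt with rfl | ht
  · filter_upwards [gt_mem_nhds hε] with u hu _
    split_ifs
    exacts [hε, max_lt hε hu]
  · filter_upwards [hT.eventually_eq ht] with u hu huT
    simpa [hu huT] using hε

open Topology in
theorem IsUltrametricGen.exists_ball_subset {X : Type*} [TopologicalSpace X] {d : X → X → ℝ}
    (hd : IsUltrametricGen d) {x : X} {s : Set X} (hs : s ∈ 𝓝 x) :
    ∃ ε > 0, ∀ y, d x y < ε → y ∈ s := by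
  obtain ⟨u, hus, hu, hxu⟩ := mem_nhds_iff.1 hs
  obtain ⟨ε, hε, h⟩ := (hd.2.2.2.2 u).1 hu x hxu
  exact ⟨ε, hε, fun y hy => hus (h y hy)⟩

/-- **Making an ultrametric proper using a proper function.** Let `S` be an
unbounded characteristic subset of `[0, ∞)`, `T ⊆ S` sporadic, `X` an
ultrametrizable space, `f : X → T` continuous and proper, and `d` an `S`-valued
ultrametric generating the topology of `X`. Then
`D(x, y) = max (d x y) (M_T(f x, f y))` is an `S`-valued ultrametric generating
the topology of `X`, and `D` is proper. -/
theorem max_ultrametric_proper_of_proper_function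
    {X : Type*} [TopologicalSpace X]
    (hXu : ∃ u : X → X → ℝ, IsUltrametricGen u)
    (S : Set ℝ) (hS : IsCharacteristic S) (hSu : ¬ BddAbove S)
    (T : Set ℝ) (hT : Sporadic T) (hTS : T ⊆ S)
    (f : X → ℝ) (hfT : ∀ x, f x ∈ T) (hfc : Continuous f)
    (hfp : ∀ K : Set ℝ, K ⊆ T → IsCompact K → IsCompact (f ⁻¹' K))
    (d : X → X → ℝ) (hd : IsUltrametricGen d) (hdS : ∀ x y, d x y ∈ S) :
    IsUltrametricGen
        (fun x y => max (d x y) (if f x = f y then 0 else max (f x) (f y))) ∧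
      (∀ x y,
        max (d x y) (if f x = f y then 0 else max (f x) (f y)) ∈ S) ∧
      IsProperMetric
        (fun x y => max (d x y) (if f x = f y then 0 else max (f x) (f y))) := by
  have hT₀ : T ⊆ Set.Ici 0 := hTS.trans hS.1
  have hf₀ : ∀ x, 0 ≤ f x := fun x => hT₀ (hfT x)
  have hball := fun x (s : Set X) => hd.exists_ball_subset (x := x) (s := s)
  obtain ⟨hnn, heq, hsymm, htri, hopen⟩ := hd
  refine ⟨⟨fun x y => le_max_of_le_left (hnn x y), fun x y => ⟨fun h => ?_, ?_⟩, fun x y => ?_,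
    fun x y z => ?_, fun s => ?_⟩, fun x y => ?_, fun s hs ⟨C, hC⟩ => ?_⟩
  · exact (heq x y).1 (le_antisymm (h ▸ le_max_left _ _) (hnn x y))
  · rintro rfl
    simp [(heq x x).2 rfl]
  · simp only [hsymm x y, eq_comm (a := f x), max_comm (f x)]
  · have hM : (if f x = f z then 0 else max (f x) (f z)) ≤
        max (if f x = f y then 0 else max (f x) (f y))
          (if f y = f z then 0 else max (f y) (f z)) := by
      have := hf₀ x
      have := hf₀ y
      have := hf₀ z
      grind
    calc _ ≤ max (max (d x y) (d y z)) _ := max_le_max (htri x y z) hM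
      _ = _ := max_max_max_comm _ _ _ _
  · rw [hopen s]
    refine forall₂_congr fun x _ => ⟨?_, ?_⟩
    · rintro ⟨ε, hε, h⟩
      exact ⟨ε, hε, fun y hy => h y ((le_max_left _ _).trans_lt hy)⟩
    · rintro ⟨ε, hε, h⟩
      obtain ⟨δ, hδ, hδf⟩ :=
        hball x _ (hfc.continuousAt.eventually (hT.eventually_max_lt (hf₀ x) hε))
      exact ⟨min ε δ, lt_min hε hδ, fun y hy => h y <|
        max_lt (hy.trans_le (min_le_left _ _)) (hδf y (hy.trans_le (min_le_right _ _)) (hfT y))⟩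
  · have hx := hTS (hfT x)
    have hy := hTS (hfT y)
    have hxy := hdS x y
    have := hS.2.1
    grind
  · rcases s.eq_empty_or_nonempty with rfl | ⟨x, hx⟩
    · exact isCompact_empty
    have hK : IsCompact (T ∩ Set.Icc 0 (max C (f x))) :=
      isCompact_Icc.inter_left (hT.isClosed hT₀)
    refine (hfp _ Set.inter_subset_left hK).of_isClosed_subset hs fun y hy => ⟨hfT y, hf₀ y, ?_⟩
    have := hC x hx y hy
    grind
end

section
/- Let X be a strongly 0-dimensional, σ-compact, locally compact metrizable topological space, let A be a closed subset of X, and let Y be a non-compact metrizable topological space. Then every continuous proper map f : A → Y extends to a continuous proper map F : X → Y with F restricted to A equal to f. -/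
open Set Filter Topology TopologicalSpace

/-- A noncompact metrizable space contains a sequence that leaves every compact set. -/
theorem exists_seq_finite_preimage_of_isCompact (Y : Type*) [TopologicalSpace Y]
    [MetrizableSpace Y] [NoncompactSpace Y] :
    ∃ y : ℕ → Y, ∀ K : Set Y, IsCompact K → (y ⁻¹' K).Finite := by
  let _ := metrizableSpaceMetric Y
  have h : ¬ IsSeqCompact (univ : Set Y) := fun h => noncompact_univ Y h.isCompact
  simp only [IsSeqCompact, mem_univ, true_and, forall_const, not_forall, not_exists, not_and] at h
  obtain ⟨y, hy⟩ := h
  refine ⟨y, fun K hK => ?_⟩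
  by_contra hinf
  obtain ⟨a, -, φ, hφ, hlim⟩ := hK.tendsto_subseq' (Nat.frequently_atTop_iff_infinite.2 hinf)
  exact hy a φ hφ hlim

namespace StronglyZeroDimensional

variable {X : Type*} [TopologicalSpace X]

/-- In a strongly zero-dimensional space, a closed set inside an open set can be separated from the
complement by a clopen set. -/
theorem exists_isClopen_between (hX : StronglyZeroDimensional X) {C U : Set X}
    (hC : IsClosed C) (hU : IsOpen U) (hCU : C ⊆ U) : ∃ V, IsClopen V ∧ C ⊆ V ∧ V ⊆ U := by
  obtain ⟨V, hV, hCV, hd⟩ := hX C Uᶜ hC hU.isClosed_compl (disjoint_compl_right_iff_subset.2 hCU)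
  exact ⟨V, hV, hCV, disjoint_compl_right_iff_subset.1 hd⟩

theorem isTopologicalBasis_isClopen [T1Space X] (hX : StronglyZeroDimensional X) :
    IsTopologicalBasis {V : Set X | IsClopen V} := by
  refine isTopologicalBasis_of_isOpen_of_nhds (fun V hV => hV.isOpen) fun x U hx hU => ?_
  obtain ⟨V, hV, hxV, hVU⟩ :=
    hX.exists_isClopen_between isClosed_singleton hU (singleton_subset_iff.2 hx)
  exact ⟨V, hV, hxV rfl, hVU⟩

/-- A σ-compact, locally compact, strongly zero-dimensional Hausdorff space is partitioned into
countably many compact clopen sets, here given as the fibers of a map to `ℕ`. -/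
theorem exists_continuous_nat_isCompact_preimage [T2Space X] [SigmaCompactSpace X]
    [LocallyCompactSpace X] (hX : StronglyZeroDimensional X) :
    ∃ n : X → ℕ, Continuous n ∧ ∀ T : Set ℕ, T.Finite → IsCompact (n ⁻¹' T) := by
  classical
  let K : CompactExhaustion X := default
  choose V hV hKV hVK using fun i =>
    hX.exists_isClopen_between (K.isCompact i).isClosed isOpen_interior (K.subset_interior_succ i)
  have hVc : ∀ i, IsCompact (V i) := fun i =>
    (K.isCompact (i + 1)).of_isClosed_subset (hV i).isClosed ((hVK i).trans interior_subset)
  have hex : ∀ x, ∃ i, x ∈ V i := fun x => (K.exists_mem x).imp fun i hi => hKV i hi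
  have hsub : ∀ i, (fun x => Nat.find (hex x)) ⁻¹' {i} ⊆ V i := by
    rintro i x rfl
    exact Nat.find_spec (hex x)
  have hcont : Continuous fun x => Nat.find (hex x) := by
    rw [continuous_discrete_rng]
    intro i
    have : (fun x => Nat.find (hex x)) ⁻¹' {i} = V i ∩ ⋂ j ∈ Iio i, (V j)ᶜ := by
      ext x
      simp [Nat.find_eq_iff]
    rw [this]
    exact (hV i).isOpen.inter
      ((finite_Iio i).isOpen_biInter fun j _ => (hV j).isClosed.isOpen_compl)
  refine ⟨_, hcont, fun T hT => ?_⟩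
  refine (hT.isCompact_biUnion fun i _ => hVc i).of_isClosed_subset
    ((isClosed_discrete T).preimage hcont) fun x hx => ?_
  exact mem_biUnion hx (hsub _ rfl)

/-- A second countable strongly zero-dimensional space with a proper map to `ℕ` embeds as a closed
subspace of the Baire space. -/
theorem exists_isClosedEmbedding_nat [T2Space X] [SecondCountableTopology X]
    (hX : StronglyZeroDimensional X) {n : X → ℕ} (hn : Continuous n)
    (hnp : ∀ T : Set ℕ, T.Finite → IsCompact (n ⁻¹' T)) :
    ∃ e : X → ℕ → ℕ, IsClosedEmbedding e := by
  obtain ⟨B, hB, hBc, hBb⟩ := hX.isTopologicalBasis_isClopen.exists_countable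
  obtain ⟨U, hU⟩ := (hBc.insert ∅).exists_eq_range (insert_nonempty _ _)
  have hUc : ∀ k, IsClopen (U k) := fun k => by
    have : U k ∈ insert ∅ B := hU ▸ mem_range_self k
    rcases this with h | h
    · rw [h]; exact isClopen_empty
    · exact hB h
  let e : X → ℕ → ℕ := fun x k => Nat.casesOn k (n x) fun k => (U k).indicator 1 x
  have he : Continuous e := by
    refine continuous_pi fun k => ?_
    cases k with
    | zero => exact hn
    | succ k => exact (IsClopen.continuous_indicator (hUc k) continuous_one)
  have hinj : Function.Injective e := by
    intro x z hxz
    by_contra hne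
    obtain ⟨W, hW, hxW, hzW⟩ :=
      hBb.exists_subset_of_mem_open (show x ∈ ({z}ᶜ : Set X) from hne) isOpen_compl_singleton
    obtain ⟨k, rfl⟩ : W ∈ range U := hU ▸ mem_insert_of_mem _ hW
    have hz : z ∉ U k := fun h => hzW h rfl
    have := congrFun hxz (k + 1)
    simp [e, hxW, hz] at this
  have hproper : IsProperMap e := by
    refine isProperMap_iff_isCompact_preimage.2 ⟨he, fun K hK => ?_⟩
    have hfin : ((fun g : ℕ → ℕ => g 0) '' K).Finite :=
      (hK.image (continuous_apply 0)).finite_of_discrete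
    exact (hnp _ hfin).of_isClosed_subset (hK.isClosed.preimage he) fun x hx => ⟨e x, hx, rfl⟩
  exact ⟨e, .of_continuous_injective_isClosedMap he hinj hproper.isClosedMap⟩

end StronglyZeroDimensional

/-- Nonempty closed subsets of a closed subspace of the Baire space are retracts. -/
theorem Topology.IsClosedEmbedding.exists_retraction {X : Type*} [TopologicalSpace X]
    {e : X → ℕ → ℕ} (he : IsClosedEmbedding e) {A : Set X} (hA : IsClosed A) (hne : A.Nonempty) :
    ∃ r : X → A, Continuous r ∧ ∀ a : A, r a = a := by
  have heA : IsClosedEmbedding (e ∘ ((↑) : A → X)) := he.comp hA.isClosedEmbedding_subtypeVal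
  have := hne.to_subtype
  obtain ⟨ρ, hρ, -, hρc⟩ :=
    PiNat.exists_retraction_subtype_of_isClosed heA.isClosed_range (range_nonempty _)
  let φ := heA.isEmbedding.toHomeomorph
  refine ⟨fun x => φ.symm (ρ (e x)), φ.symm.continuous.comp (hρc.comp he.continuous), fun a => ?_⟩
  rw [φ.symm_apply_eq]
  exact hρ (φ a)

/-- **Extension of proper maps.** Let `X` be a strongly 0-dimensional σ-compact
locally compact metrizable space, `A` a closed subset of `X`, and `Y` a
non-compact metrizable space. Every continuous proper map `f : A → Y` extends
to a continuous proper map `F : X → Y`. -/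
theorem extend_proper_map
    {X : Type*} [TopologicalSpace X] [TopologicalSpace.MetrizableSpace X]
    [SigmaCompactSpace X] [LocallyCompactSpace X]
    (hX : StronglyZeroDimensional X)
    (A : Set X) (hA : IsClosed A)
    {Y : Type*} [TopologicalSpace Y] [TopologicalSpace.MetrizableSpace Y]
    [NoncompactSpace Y]
    (f : A → Y) (hfc : Continuous f)
    (hfp : ∀ K : Set Y, IsCompact K → IsCompact (f ⁻¹' K)) :
    ∃ F : X → Y, Continuous F ∧
      (∀ K : Set Y, IsCompact K → IsCompact (F ⁻¹' K)) ∧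
      ∀ a : A, F a = f a := by
  let _ := metrizableSpaceMetric X
  have : SecondCountableTopology X := EMetric.secondCountable_of_sigmaCompact X
  obtain ⟨n, hn, hnp⟩ := hX.exists_continuous_nat_isCompact_preimage
  obtain ⟨y, hy⟩ := exists_seq_finite_preimage_of_isCompact Y
  have hyn : Continuous (y ∘ n) := continuous_of_discreteTopology.comp hn
  rcases A.eq_empty_or_nonempty with rfl | hne
  · exact ⟨y ∘ n, hyn, fun K hK => hnp _ (hy K hK), fun a => a.2.elim⟩
  obtain ⟨e, he⟩ := hX.exists_isClosedEmbedding_nat hn hnp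
  obtain ⟨r, hr, hrA⟩ := he.exists_retraction hA hne
  have hnr : Continuous fun x => n (r x) := hn.comp (continuous_subtype_val.comp hr)
  have hclopen : IsClopen {x | n (r x) = n x} :=
    (isClopen_discrete {p : ℕ × ℕ | p.1 = p.2}).preimage (hnr.prodMk hn)
  have hF : Continuous fun x => if n (r x) = n x then f (r x) else y (n x) := by
    refine Continuous.if (fun x hx => ?_) (hfc.comp hr) hyn
    simp [hclopen.frontier_eq] at hx
  refine ⟨_, hF, fun K hK => ?_, fun a => by simp [hrA]⟩
  have hfin : ((fun a : A => n a) '' (f ⁻¹' K)).Finite :=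
    ((hfp K hK).image (hn.comp continuous_subtype_val)).finite_of_discrete
  refine (hnp _ (hfin.union (hy K hK))).of_isClosed_subset (hK.isClosed.preimage hF) fun x hx => ?_
  by_cases h : n (r x) = n x
  · exact Or.inl ⟨r x, by simpa [h] using hx, h⟩
  · exact Or.inr (by simpa [h] using hx)
end
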